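/- Fix an integer p ≥ 2 and suppose the complex numbers z₁, …, z_{2p−1} satisfy the gluing system. If Re(z₁) = 1, then Im(z₁) = 0. -/

import Mathlib

/-- The gluing system for the `p`-th twist knot: `z 1, …, z (2p-1)` are complex numbers,
none of which is a nonnegative real number, satisfying the critical-point equations of
the potential function `f`. -/
def GluingSystem (p : ℕ) (z : ℕ → ℂ) : Prop :=
  (∀ i : ℕ, 1 ≤ i → i ≤ 2 * p - 1 → ¬ ∃ r : ℝ, 0 ≤ r ∧ z i = (r : ℂ)) ∧
  (1 - z 1 / z 2 = (1 - z 1) * (1 - 1 / z 1)) ∧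
  (∀ i : ℕ, 2 ≤ i → i ≤ 2 * p - 2 →
    (1 - z i / z (i + 1)) * (1 - 1 / z i) = (1 - z i) * (1 - z (i - 1) / z i)) ∧
  (1 - 1 / z (2 * p - 1) = (1 - z (2 * p - 1)) * (1 - z (2 * p - 2) / z (2 * p - 1)))

/-- Fibonacci polynomials evaluated at `s`. -/
def fibS {R : Type*} [CommRing R] (s : R) : ℕ → R
  | 0 => 0
  | 1 => 1
  | (n + 2) => s * fibS s (n + 1) + fibS s n

/-- Divided differences of the Fibonacci polynomials at `s, t`. -/
def fibD {R : Type*} [CommRing R] (s t : R) : ℕ → R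
  | 0 => 0
  | 1 => 0
  | (n + 2) => fibS s (n + 1) + t * fibD s t (n + 1) + fibD s t n

theorem fibS_map {R S : Type*} [CommRing R] [CommRing S] (f : R →+* S) (s : R) (n : ℕ) :
    f (fibS s n) = fibS (f s) n := by
  induction n using Nat.twoStepInduction with
  | zero => simp [fibS]
  | one => simp [fibS]
  | more n h1 h2 => simp [fibS, h1, h2]

theorem fibD_map {R S : Type*} [CommRing R] [CommRing S] (f : R →+* S) (s t : R) (n : ℕ) :
    f (fibD s t n) = fibD (f s) (f t) n := by
  induction n using Nat.twoStepInduction with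
  | zero => simp [fibD]
  | one => simp [fibD]
  | more n h1 h2 => simp [fibD, h1, h2, fibS_map]

theorem fibD_spec {R : Type*} [CommRing R] (s t : R) (n : ℕ) :
    fibS s n - fibS t n = (s - t) * fibD s t n := by
  induction n using Nat.twoStepInduction with
  | zero => simp [fibS, fibD]
  | one => simp [fibS, fibD]
  | more n h1 h2 =>
    simp only [fibS, fibD]
    linear_combination t * h2 + h1

theorem fibD_char2 {K : Type*} [CommRing K] (h2 : (2 : K) = 0) (s : K) (n : ℕ) :
    s * fibD s s n = ((n : K) - 1) * fibS s n := by
  induction n using Nat.twoStepInduction with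
  | zero => simp [fibS, fibD]
  | one => simp [fibS, fibD]
  | more n h1 h3 =>
    simp only [fibS, fibD]
    push_cast at *
    linear_combination s * h3 + h1 - fibS s n * h2

theorem fibS_coprime {K : Type*} [CommRing K] [Nontrivial K] (s : K) (n : ℕ)
    (h0 : fibS s n = 0) (h1 : fibS s (n + 1) = 0) : False := by
  induction n with
  | zero => simp [fibS] at h1
  | succ n ih =>
    refine ih ?_ h0
    simp only [fibS] at h1
    simpa [h0] using h1

open Polynomial in
theorem fibS_monic (n : ℕ) : (fibS (X : ℤ[X]) (n + 1)).Monic ∧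
    (fibS (X : ℤ[X]) (n + 1)).degree = n ∧ (fibS (X : ℤ[X]) n).degree < n := by
  induction n with
  | zero => simp [fibS]
  | succ n ih =>
    obtain ⟨h1, h2, h3⟩ := ih
    have hm : (X * fibS (X : ℤ[X]) (n + 1)).Monic := monic_X.mul h1
    have hd : (X * fibS (X : ℤ[X]) (n + 1)).degree = ((n + 1 : ℕ) : WithBot ℕ) := by
      rw [degree_mul, h2, degree_X]; push_cast; rw [add_comm]
    have hlt : ((n : ℕ) : WithBot ℕ) < ((n + 1 : ℕ) : WithBot ℕ) := by
      exact_mod_cast Nat.lt_succ_self n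
    have hl : (fibS (X : ℤ[X]) n).degree < (X * fibS (X : ℤ[X]) (n + 1)).degree := by
      rw [hd]; exact h3.trans hlt
    refine ⟨?_, ?_, ?_⟩
    · exact hm.add_of_left hl
    · show (X * fibS (X : ℤ[X]) (n + 1) + fibS X n).degree = _
      rw [degree_add_eq_left_of_degree_lt hl, hd]
    · rw [h2]; exact hlt

open Polynomial in
theorem fib_integral (s : ℂ) (n : ℕ) (h : fibS s (n + 1) + fibS s n = 0) : IsIntegral ℤ s := by
  obtain ⟨h1, h2, h3⟩ := fibS_monic n
  refine ⟨fibS X (n + 1) + fibS X n, h1.add_of_left (by rw [h2]; exact h3), ?_⟩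
  have := fibS_map (eval₂RingHom (algebraMap ℤ ℂ) s) X
  simp only [coe_eval₂RingHom, eval₂_X] at this
  rw [eval₂_add, this, this, h]

theorem exists_max : ∃ m : Ideal (integralClosure ℤ ℂ), m.IsMaximal ∧ (2 : integralClosure ℤ ℂ) ∈ m := by
  have : Ideal.span {(2 : integralClosure ℤ ℂ)} ≠ ⊤ := by
    rw [Ne, Ideal.span_singleton_eq_top]
    intro hu
    obtain ⟨u, hu⟩ := hu.exists_right_inv
    have h1 : (2 : ℂ) * (u : ℂ) = 1 := by
      have := congrArg (integralClosure ℤ ℂ).val.toRingHom hu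
      rw [map_mul, map_one, map_ofNat] at this
      exact this
    have h2 : IsIntegral ℤ (u : ℂ) := u.2
    have h3 : (u : ℂ) = algebraMap ℚ ℂ (1 / 2) := by
      rw [map_div₀]; simp
      linear_combination h1 / 2
    rw [h3, isIntegral_algebraMap_iff (algebraMap ℚ ℂ).injective] at h2
    obtain ⟨k, hk⟩ := IsIntegrallyClosed.isIntegral_iff.1 h2
    have h4 : (k : ℚ) * 2 = 1 := by
      have : (k : ℚ) = 1 / 2 := by simpa using hk
      rw [this]; norm_num
    have h5 : k * 2 = 1 := by exact_mod_cast h4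
    omega
  obtain ⟨m, hm, hle⟩ := Ideal.exists_le_maximal _ this
  exact ⟨m, hm, hle (Ideal.mem_span_singleton_self _)⟩

theorem fib_key (s t : ℂ) (n : ℕ) (hs : fibS s (n + 1) + fibS s n = 0)
    (ht : fibS t (n + 1) + fibS t n = 0) (hst : s + t + 2 * (s * t) = 0) (hne : s ≠ t) : False := by
  obtain ⟨m, hm, h2m⟩ := exists_max
  have hd : fibD s t (n + 1) + fibD s t n = 0 := by
    have h1 := fibD_spec s t (n + 1)
    have h2 := fibD_spec s t n
    apply mul_left_cancel₀ (sub_ne_zero.2 hne)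
    linear_combination hs - ht - h1 - h2
  let sA : integralClosure ℤ ℂ := ⟨s, fib_integral s n hs⟩
  let tA : integralClosure ℤ ℂ := ⟨t, fib_integral t n ht⟩
  let ι : integralClosure ℤ ℂ →+* ℂ := (integralClosure ℤ ℂ).val.toRingHom
  have hι : Function.Injective ι := Subtype.val_injective
  have hιs : ι sA = s := rfl
  have hιt : ι tA = t := rfl
  have hsA : fibS sA (n + 1) + fibS sA n = 0 := by
    apply hι; rw [map_add, fibS_map, fibS_map, map_zero, hιs, hs]
  have hdA : fibD sA tA (n + 1) + fibD sA tA n = 0 := by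
    apply hι; rw [map_add, fibD_map, fibD_map, map_zero, hιs, hιt, hd]
  have hstA : sA + tA + 2 * (sA * tA) = 0 := by
    apply hι; simp only [map_add, map_mul, map_zero, hιs, hιt, map_ofNat, hst]
  let φ := Ideal.Quotient.mk m
  have h2 : (2 : integralClosure ℤ ℂ ⧸ m) = 0 := by
    have := Ideal.Quotient.eq_zero_iff_mem.2 h2m
    rw [map_ofNat] at this
    exact this
  have e1 := congrArg φ hsA
  have e2 := congrArg φ hdA
  have e3 := congrArg φ hstA
  simp only [map_add, map_mul, map_zero, fibS_map, fibD_map, map_ofNat] at e1 e2 e3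
  generalize φ sA = a at *
  generalize φ tA = b at *
  have hab : b = a := by linear_combination e3 - (a * b + a) * h2
  subst hab
  have : Nontrivial (integralClosure ℤ ℂ ⧸ m) := Ideal.Quotient.nontrivial_iff.2 hm.ne_top
  have f1 := fibD_char2 h2 b (n + 1)
  have f2 := fibD_char2 h2 b n
  push_cast at f1
  have e4 : (n : integralClosure ℤ ℂ ⧸ m) * fibS b (n + 1) + (n - 1) * fibS b n = 0 := by
    linear_combination b * e2 - f1 - f2
  have e5 : fibS b n = 0 := by linear_combination n * e1 - e4
  exact fibS_coprime b n e5 (by linear_combination e1 - e5)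

theorem gluing_fib (p : ℕ) (hp : 2 ≤ p) (z : ℕ → ℂ) (hz : GluingSystem p z) :
    fibS (1 / z 1 - 1) (2 * p + 1) + fibS (1 / z 1 - 1) (2 * p) = 0 := by
  obtain ⟨h0, h1, h2, h3⟩ := hz
  have nz : ∀ i, 1 ≤ i → i ≤ 2 * p - 1 → z i ≠ 0 := fun i a b c =>
    h0 i a b ⟨0, le_rfl, by simpa using c⟩
  have n1 : ∀ i, 1 ≤ i → i ≤ 2 * p - 1 → 1 - z i ≠ 0 := fun i a b c =>
    h0 i a b ⟨1, zero_le_one, by push_cast; linear_combination -c⟩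
  have z1 := nz 1 le_rfl (by omega)
  have z2 := nz 2 (by omega) (by omega)
  have o1 := n1 1 le_rfl (by omega)
  set s : ℂ := 1 / z 1 - 1 with hs
  have hsz : s * z 1 = 1 - z 1 := by rw [hs]; field_simp
  have s0 : s ≠ 0 := by
    intro h; rw [h, zero_mul] at hsz; exact o1 hsz.symm
  have C : ∀ i, i + 2 ≤ 2 * p - 1 → (1 - z (i + 2)) * (1 - z (i + 1)) = s ^ 2 * z (i + 2) := by
    intro i
    induction i with
    | zero =>
      intro _
      simp only [zero_add]
      field_simp at h1
      apply mul_left_cancel₀ (pow_ne_zero 2 z1)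
      have : z 1 ^ 2 * (s ^ 2 * z 2) = (1 - z 1) ^ 2 * z 2 := by rw [← hsz]; ring
      rw [this]
      linear_combination -(1 - z 1) * h1
    | succ i ih =>
      intro hi
      have ih := ih (by omega)
      have e := h2 (i + 2) (by omega) (by omega)
      rw [show i + 2 - 1 = i + 1 by omega] at e
      have za := nz (i + 2) (by omega) (by omega)
      have zb := nz (i + 2 + 1) (by omega) (by omega)
      have oa := n1 (i + 2) (by omega) (by omega)
      rw [show i + 1 + 2 = i + 2 + 1 by omega, show i + 1 + 1 = i + 2 by omega]
      field_simp at e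
      apply mul_left_cancel₀ za
      linear_combination z (i + 2 + 1) * ih + e
  have U : ∀ i, i + 1 ≤ 2 * p - 1 →
      (1 - z (i + 1)) * (fibS s (i + 2) + fibS s (i + 1)) = s * (fibS s (i + 1) + fibS s i) := by
    intro i
    induction i with
    | zero =>
      intro _
      simp [fibS]
      linear_combination -hsz
    | succ i ih =>
      intro hi
      have ih := ih (by omega)
      have c := C i (by omega)
      apply mul_left_cancel₀ s0
      simp only [fibS, show i + 1 + 1 = i + 2 by omega, show i + 1 + 2 = i + 1 + 2 by omega] at *
      linear_combination (-(1 - z (i+2))) * ih + (s * fibS s (i + 1) + fibS s i + fibS s (i+1)) * c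
  obtain ⟨q, rfl⟩ : ∃ q, p = q + 2 := ⟨p - 2, by omega⟩
  rw [show 2 * (q + 2) - 1 = 2 * q + 3 by omega, show 2 * (q + 2) - 2 = 2 * q + 2 by omega] at *
  have c := C (2 * q + 1) (by omega)
  have u := U (2 * q + 2) (by omega)
  simp only [Nat.reduceAdd, add_assoc] at c u
  have zn := nz (2 * q + 3) (by omega) (by omega)
  have on := n1 (2 * q + 3) (by omega) (by omega)
  field_simp at h3
  have h4 : z (2 * q + 2) = z (2 * q + 3) + 1 := by
    apply mul_left_cancel₀ on
    linear_combination h3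
  have h5 : 1 - z (2 * q + 3) = -s ^ 2 := by
    apply mul_left_cancel₀ zn
    rw [h4] at c
    linear_combination -c
  rw [h5] at u
  rw [show 2 * (q + 2) + 1 = 2 * q + 3 + 2 by omega, show 2 * (q + 2) = 2 * q + 2 + 2 by omega]
  apply mul_left_cancel₀ s0
  simp only [fibS, show 2 * q + 3 + 1 = 2 * q + 2 + 2 by omega,
    show 2 * q + 2 + 1 = 2 * q + 3 by omega, show 2 * q + 4 = 2 * q + 2 + 2 by omega] at *
  linear_combination -u

theorem re_z1_eq_one_imp_im_eq_zero (p : ℕ) (hp : 2 ≤ p) (z : ℕ → ℂ)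
    (hz : GluingSystem p z) (h : (z 1).re = 1) : (z 1).im = 0 := by
  by_contra him
  have hs := gluing_fib p hp z hz
  have z1 : z 1 ≠ 0 := by intro h0; rw [h0] at h; simp at h
  have ht := congrArg (starRingEnd ℂ) hs
  rw [map_add, fibS_map, fibS_map, map_zero] at ht
  have hc : (starRingEnd ℂ) (1 / z 1 - 1) = 1 / (2 - z 1) - 1 := by
    have : (starRingEnd ℂ) (z 1) = 2 - z 1 := by
      apply Complex.ext <;> simp [h]; norm_num
    simp [this]
  have z2 : 2 - z 1 ≠ 0 := by
    intro h0
    have := congrArg Complex.im h0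
    simp at this
    exact him this
  rw [hc] at ht
  refine fib_key _ _ _ hs ht ?_ ?_
  · field_simp; ring
  · intro e
    have e : 1 / z 1 = 1 / (2 - z 1) := by linear_combination e
    rw [div_eq_div_iff z1 z2] at e
    have := congrArg Complex.im e
    simp at this
    apply him; linarith
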